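/- arXiv:1506.05848 — 13 statements merged into one kernel-verified Lean document; each statement's English description precedes it below -/
import Mathlib

section
/- Let P = p0 ∈ ℝ with p0 ≠ 0 and let Q, R, S ∈ ℍ. Set ρ = scal(S)/p0 + |Q + R*|²/(4p0²). Then a quaternion X ∈ ℍ satisfies X P X* + X Q + R X* = S if and only if the quaternion Y = X + (Q* + R)/(2p0) satisfies both |Y|² = ρ and vect(Y (Q − R*)) = vect(S + R Q / p0). -/
open Quaternion

/-- reduction of the quadratic quaternion equation with real `P = p0` to the
system `|Y|² = ρ` and `vect(Y(Q − R*)) = vect(S + RQ/p0)` via the translation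
`Y = X + (Q* + R)/(2 p0)`. -/
theorem quadratic_quaternion_real_reduction (p0 : ℝ) (hp0 : p0 ≠ 0) (Q R S : ℍ[ℝ])
    (ρ : ℝ) (hρ : ρ = S.re / p0 + ‖Q + star R‖ ^ 2 / (4 * p0 ^ 2)) (X : ℍ[ℝ]) :
    X * (p0 : ℍ[ℝ]) * star X + X * Q + R * star X = S ↔
      ‖X + (star Q + R) / (2 * (p0 : ℍ[ℝ]))‖ ^ 2 = ρ ∧
        ((X + (star Q + R) / (2 * (p0 : ℍ[ℝ]))) * (Q - star R)).im
          = (S + R * Q / (p0 : ℍ[ℝ])).im := by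
  have h_norm (a : ℍ[ℝ]) : ‖a‖ ^ 2 = a.re ^ 2 + a.imI ^ 2 + a.imJ ^ 2 + a.imK ^ 2 := by
    rw [sq, ← Quaternion.normSq_eq_norm_mul_self, Quaternion.normSq_def']
  have h_half : (star Q + R) / (2 * (p0 : ℍ[ℝ])) = (2 * p0)⁻¹ • (star Q + R) := by
    have h : (2 * (p0 : ℍ[ℝ])) = ((2 * p0 : ℝ) : ℍ[ℝ]) := by push_cast; rfl
    rw [h, div_eq_mul_inv, ← Quaternion.coe_inv, Quaternion.mul_coe_eq_smul]
  have h_div : R * Q / (p0 : ℍ[ℝ]) = p0⁻¹ • (R * Q) := by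
    rw [div_eq_mul_inv, ← Quaternion.coe_inv, Quaternion.mul_coe_eq_smul]
  have h_sq : ρ = p0⁻¹ * S.re + p0⁻¹ ^ 2 / 4 * ‖Q + star R‖ ^ 2 := by
    rw [hρ]; field_simp
  rw [h_half, h_div, h_sq, h_norm, h_norm, mul_inv, Quaternion.mul_coe_eq_smul]
  obtain ⟨c, hc⟩ : ∃ c, c = p0⁻¹ := ⟨_, rfl⟩
  have hcp : c * p0 = 1 := by rw [hc, inv_mul_cancel₀ hp0]
  rw [← hc]
  simp only [Quaternion.ext_iff, Quaternion.re_add, Quaternion.imI_add, Quaternion.imJ_add,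
    Quaternion.imK_add, Quaternion.re_mul, Quaternion.imI_mul, Quaternion.imJ_mul,
    Quaternion.imK_mul, Quaternion.re_star, Quaternion.imI_star, Quaternion.imJ_star,
    Quaternion.imK_star, Quaternion.re_smul, Quaternion.imI_smul, Quaternion.imJ_smul,
    Quaternion.imK_smul, Quaternion.re_sub, Quaternion.imI_sub, Quaternion.imJ_sub,
    Quaternion.imK_sub, Quaternion.re_im, Quaternion.imI_im, Quaternion.imJ_im,
    Quaternion.imK_im, smul_eq_mul, true_and]
  refine and_congr ?_ (and_congr ?_ (and_congr ?_ ?_))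
  · constructor <;> intro h
    · linear_combination c * h - (X.re ^ 2 + X.imI ^ 2 + X.imJ ^ 2 + X.imK ^ 2) * hcp
    · refine mul_left_cancel₀ (left_ne_zero_of_mul_eq_one hcp) ?_
      linear_combination h + (X.re ^ 2 + X.imI ^ 2 + X.imJ ^ 2 + X.imK ^ 2) * hcp
  all_goals constructor <;> intro h <;> linear_combination h
end

section
/- Let P = p0 ∈ ℝ with p0 ≠ 0 and let Q, R, S ∈ ℍ. Set ρ = scal(S)/p0 + |Q + R*|²/(4p0²). If ρ < 0, then the equation X P X* + X Q + R X* = S has no solution X ∈ ℍ. -/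
open Quaternion

/-- if `ρ < 0`, the equation `X P X* + X Q + R X* = S` with real `P = p0 ≠ 0`
has no solution. -/
theorem quadratic_quaternion_real_no_solution_of_rho_neg (p0 : ℝ) (hp0 : p0 ≠ 0)
    (Q R S : ℍ[ℝ]) (ρ : ℝ) (hρ : ρ = S.re / p0 + ‖Q + star R‖ ^ 2 / (4 * p0 ^ 2))
    (hneg : ρ < 0) :
    ¬ ∃ X : ℍ[ℝ], X * (p0 : ℍ[ℝ]) * star X + X * Q + R * star X = S := by
  rintro ⟨X, rfl⟩
  have hsq : ρ = ‖X + (2 * p0)⁻¹ • star (Q + star R)‖ ^ 2 := by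
    rw [hρ]
    simp only [sq ‖_‖, ← Quaternion.normSq_eq_norm_mul_self, Quaternion.normSq_def']
    simp
    field_simp
    ring
  exact hneg.not_ge (hsq ▸ sq_nonneg _)
end

section
/- Let P = p0 ∈ ℝ with p0 ≠ 0 and let Q, R, S ∈ ℍ. Set ρ = scal(S)/p0 + |Q + R*|²/(4p0²) and suppose ρ = 0. If vect(S + R Q / p0) = 0, then X = −(Q* + R)/(2p0) is the unique solution in ℍ of X P X* + X Q + R X* = S; if vect(S + R Q / p0) ≠ 0, then this equation has no solution in ℍ. -/
open Quaternion

theorem eq_zero_of_sum_four_sq_eq_zero {u v w z : ℝ} (h : u ^ 2 + v ^ 2 + w ^ 2 + z ^ 2 = 0) :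
    u = 0 ∧ v = 0 ∧ w = 0 ∧ z = 0 := by
  have hu := sq_nonneg u
  have hv := sq_nonneg v
  have hw := sq_nonneg w
  have hz := sq_nonneg z
  refine ⟨?_, ?_, ?_, ?_⟩ <;> refine pow_eq_zero_iff two_ne_zero |>.mp ?_ <;> linarith

/-- When `ρ = 0`, completing the square determines the solution `X` up to solvability, and the
remaining imaginary part of the equation is the solvability condition. -/
theorem quadratic_quaternion_eq_iff (p : ℝ) (hp : p ≠ 0) (Q R S : ℍ[ℝ])
    (h : S.re / p + ‖Q + star R‖ ^ 2 / (4 * p ^ 2) = 0) (X : ℍ[ℝ]) :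
    X * (p : ℍ[ℝ]) * star X + X * Q + R * star X = S ↔
      X = -(star Q + R) / (2 * (p : ℍ[ℝ])) ∧ (S + R * Q / (p : ℍ[ℝ])).im = 0 := by
  have hX : -(star Q + R) / (2 * (p : ℍ[ℝ])) = -(2 * p)⁻¹ • (star Q + R) := by
    have h2 : (2 * (p : ℍ[ℝ])) = ((2 * p : ℝ) : ℍ[ℝ]) := by push_cast; rfl
    rw [h2, div_eq_mul_inv, ← Quaternion.coe_inv, Quaternion.mul_coe_eq_smul, smul_neg, neg_smul]
  have hV : R * Q / (p : ℍ[ℝ]) = p⁻¹ • (R * Q) := by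
    rw [div_eq_mul_inv, ← Quaternion.coe_inv, Quaternion.mul_coe_eq_smul]
  have hS : 4 * p * S.re + ((Q.re + R.re) ^ 2 + (Q.imI - R.imI) ^ 2 + (Q.imJ - R.imJ) ^ 2
      + (Q.imK - R.imK) ^ 2) = 0 := by
    have hn : ‖Q + star R‖ ^ 2 = (Q.re + R.re) ^ 2 + (Q.imI - R.imI) ^ 2 + (Q.imJ - R.imJ) ^ 2
        + (Q.imK - R.imK) ^ 2 := by
      rw [sq, ← Quaternion.normSq_eq_norm_mul_self, Quaternion.normSq_def']
      simp [sub_eq_add_neg]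
    rw [hn] at h
    field_simp at h
    linarith
  rw [hX, hV]
  simp only [Quaternion.ext_iff, Quaternion.re_add, Quaternion.imI_add, Quaternion.imJ_add,
    Quaternion.imK_add, Quaternion.re_mul, Quaternion.imI_mul, Quaternion.imJ_mul,
    Quaternion.imK_mul, Quaternion.re_star, Quaternion.imI_star, Quaternion.imJ_star,
    Quaternion.imK_star, Quaternion.re_coe, Quaternion.imI_coe, Quaternion.imJ_coe,
    Quaternion.imK_coe, Quaternion.re_smul, Quaternion.imI_smul, Quaternion.imJ_smul,
    Quaternion.imK_smul, Quaternion.re_im, Quaternion.imI_im, Quaternion.imJ_im,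
    Quaternion.imK_im, Quaternion.re_zero, Quaternion.imI_zero, Quaternion.imJ_zero,
    Quaternion.imK_zero, smul_eq_mul, true_and]
  obtain ⟨a, b, c, d⟩ := X
  obtain ⟨q, q1, q2, q3⟩ := Q
  obtain ⟨r, r1, r2, r3⟩ := R
  obtain ⟨s, s1, s2, s3⟩ := S
  dsimp only at hS ⊢
  constructor
  · rintro ⟨e0, e1, e2, e3⟩
    have hsum : (2 * p * a + (q + r)) ^ 2 + (2 * p * b + (-q1 + r1)) ^ 2
        + (2 * p * c + (-q2 + r2)) ^ 2 + (2 * p * d + (-q3 + r3)) ^ 2 = 0 := by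
      linear_combination 4 * p * e0 + hS
    have solve (x y : ℝ) (hxy : 2 * p * x + y = 0) : x = -(2 * p)⁻¹ * y := by
      field_simp
      linarith
    obtain ⟨ha, hb, hc, hd⟩ := eq_zero_of_sum_four_sq_eq_zero hsum
    replace ha := solve _ _ ha
    replace hb := solve _ _ hb
    replace hc := solve _ _ hc
    replace hd := solve _ _ hd
    refine ⟨⟨ha, hb, hc, hd⟩, ?_, ?_, ?_⟩
    · rw [← e1, ha, hb, hc, hd]; field_simp; ring
    · rw [← e2, ha, hb, hc, hd]; field_simp; ring
    · rw [← e3, ha, hb, hc, hd]; field_simp; ring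
  · rintro ⟨⟨rfl, rfl, rfl, rfl⟩, e1, e2, e3⟩
    refine ⟨?_, ?_, ?_, ?_⟩
    · field_simp
      linear_combination -p * hS
    · rw [eq_neg_of_add_eq_zero_left e1]; field_simp; ring
    · rw [eq_neg_of_add_eq_zero_left e2]; field_simp; ring
    · rw [eq_neg_of_add_eq_zero_left e3]; field_simp; ring

/-- the case `ρ = 0` with real `P = p0 ≠ 0`: if `vect(S + RQ/p0) = 0` then
`X = −(Q* + R)/(2 p0)` is the unique solution; otherwise there is no solution. -/
theorem quadratic_quaternion_real_rho_zero (p0 : ℝ) (hp0 : p0 ≠ 0) (Q R S : ℍ[ℝ])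
    (ρ : ℝ) (hρ : ρ = S.re / p0 + ‖Q + star R‖ ^ 2 / (4 * p0 ^ 2)) (hzero : ρ = 0) :
    ((S + R * Q / (p0 : ℍ[ℝ])).im = 0 →
      {X : ℍ[ℝ] | X * (p0 : ℍ[ℝ]) * star X + X * Q + R * star X = S}
        = {-(star Q + R) / (2 * (p0 : ℍ[ℝ]))}) ∧
    ((S + R * Q / (p0 : ℍ[ℝ])).im ≠ 0 →
      ¬ ∃ X : ℍ[ℝ], X * (p0 : ℍ[ℝ]) * star X + X * Q + R * star X = S) := by
  have key := quadratic_quaternion_eq_iff p0 hp0 Q R S (hρ.symm.trans hzero)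
  refine ⟨fun h => ?_, fun h ⟨X, hX⟩ => h ((key X).mp hX).2⟩
  ext X
  exact (key X).trans (and_iff_left h)
end

section
/- Let P = p0 ∈ ℝ with p0 ≠ 0 and let Q, R, S ∈ ℍ. Set ρ = scal(S)/p0 + |Q + R*|²/(4p0²) and suppose ρ > 0, Q = R*, and S ∈ ℝ. Then the set of solutions X ∈ ℍ of X P X* + X Q + R X* = S is exactly the 3-sphere { X ∈ ℍ : |X + (Q* + R)/(2p0)| = √ρ }. -/
open Quaternion

/-- the case `ρ > 0`, `Q = R*`, `S ∈ ℝ` with real `P = p0 ≠ 0`: the solution set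
is the 3-sphere of radius `√ρ` centered at `−(Q* + R)/(2 p0)`. -/
theorem quadratic_quaternion_real_sphere_of_solutions (p0 : ℝ) (hp0 : p0 ≠ 0) (Q R S : ℍ[ℝ])
    (ρ : ℝ) (hρ : ρ = S.re / p0 + ‖Q + star R‖ ^ 2 / (4 * p0 ^ 2))
    (hpos : 0 < ρ) (hQR : Q = star R) (hS : S.im = 0) :
    {X : ℍ[ℝ] | X * (p0 : ℍ[ℝ]) * star X + X * Q + R * star X = S}
      = {X : ℍ[ℝ] | ‖X + (star Q + R) / (2 * (p0 : ℍ[ℝ]))‖ = Real.sqrt ρ} := by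
  subst hQR
  have hS' : S = ((S.re : ℝ) : ℍ[ℝ]) := by
    rw [← Quaternion.re_add_im S, hS]; simp
  have hcenter : (star (star R) + R) / (2 * (p0 : ℍ[ℝ])) = p0⁻¹ • R := by
    have h : (2 * (p0 : ℍ[ℝ])) = ((2 * p0 : ℝ) : ℍ[ℝ]) := by push_cast; rfl
    rw [star_star, ← two_smul ℝ R, h, div_eq_mul_inv, ← Quaternion.coe_inv,
      Quaternion.mul_coe_eq_smul, smul_smul]
    congr 1
    field_simp
  have hnorm : ‖star R + star R‖ ^ 2 = 4 * normSq R := by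
    rw [← two_smul ℝ (star R), sq, ← Quaternion.normSq_eq_norm_mul_self,
      Quaternion.normSq_smul, Quaternion.normSq_star]
    norm_num
  ext X
  have hlhs : X * (p0 : ℍ[ℝ]) * star X + X * star R + R * star X
      = ((p0 * normSq X + 2 * (X * star R).re : ℝ) : ℍ[ℝ]) := by
    have h : R * star X = star (X * star R) := by simp
    rw [h, add_assoc, Quaternion.self_add_star, Quaternion.mul_coe_eq_smul, smul_mul_assoc,
      Quaternion.self_mul_star, ← Quaternion.coe_mul_eq_smul]
    push_cast
    rfl
  have hrhs : ‖X + p0⁻¹ • R‖ = Real.sqrt ρ ↔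
      normSq X + p0⁻¹ ^ 2 * normSq R + 2 * (p0⁻¹ * (X * star R).re) = ρ := by
    rw [eq_comm, Real.sqrt_eq_iff_mul_self_eq hpos.le (norm_nonneg _),
      ← Quaternion.normSq_eq_norm_mul_self, Quaternion.normSq_add, Quaternion.normSq_smul]
    simp only [Quaternion.star_smul, mul_smul_comm, Quaternion.re_smul, smul_eq_mul]
    exact eq_comm
  rw [Set.mem_ofPred_eq, Set.mem_ofPred_eq, hcenter, hrhs, hlhs, hS', Quaternion.coe_inj,
    hρ, hnorm]
  field_simp
  constructor
  · intro h
    linear_combination p0 * h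
  · intro h
    apply mul_left_cancel₀ hp0
    linear_combination h
end

section
/- Let P = p0 ∈ ℝ with p0 ≠ 0 and let Q, R, S ∈ ℍ. Set ρ = scal(S)/p0 + |Q + R*|²/(4p0²) and suppose ρ > 0, Q = R*, and S ∉ ℝ. Then the equation X P X* + X Q + R X* = S has no solution X ∈ ℍ. -/
open Quaternion

/-- the case `ρ > 0`, `Q = R*`, `S ∉ ℝ` with real `P = p0 ≠ 0`: no solution. -/
theorem quadratic_quaternion_real_no_solution_of_S_not_real (p0 : ℝ) (hp0 : p0 ≠ 0)
    (Q R S : ℍ[ℝ]) (ρ : ℝ) (hρ : ρ = S.re / p0 + ‖Q + star R‖ ^ 2 / (4 * p0 ^ 2))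
    (hpos : 0 < ρ) (hQR : Q = star R) (hS : S.im ≠ 0) :
    ¬ ∃ X : ℍ[ℝ], X * (p0 : ℍ[ℝ]) * star X + X * Q + R * star X = S := by
  rintro ⟨X, hX⟩
  have hstar : star S = S := by
    rw [← hX, hQR]
    simp only [star_add, star_mul, star_star, Quaternion.star_coe, mul_assoc]
    abel
  apply hS
  rw [Quaternion.star_eq_self] at hstar
  rw [hstar, Quaternion.im_coe]
end

section
/- Let P = p0 ∈ ℝ with p0 ≠ 0 and let Q, R, S ∈ ℍ. Set ρ = scal(S)/p0 + |Q + R*|²/(4p0²) and Δ = ρ|Q − R*|² − |vect(S + R Q / p0)|², and suppose ρ > 0, Q ≠ R*, and Δ ≥ 0. Then the set of solutions X ∈ ℍ of X P X* + X Q + R X* = S is exactly { (vect(S + R Q / p0) + √Δ)(Q − R*)^{-1} − (Q* + R)/(2p0), (vect(S + R Q / p0) − √Δ)(Q − R*)^{-1} − (Q* + R)/(2p0) }; in particular there are exactly two solutions if Δ > 0 and exactly one if Δ = 0. -/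
open Quaternion

namespace Quaternion

/-- Completing the square: the scalar part of the quadratic expression with real leading
coefficient. -/
lemma re_quadratic_eq {p : ℝ} (hp : p ≠ 0) (Q R X : ℍ[ℝ]) :
    (X * (p : ℍ[ℝ]) * star X + X * Q + R * star X).re
      = p * (‖X + (star Q + R) / (2 * (p : ℍ[ℝ]))‖ ^ 2 - ‖Q + star R‖ ^ 2 / (4 * p ^ 2)) := by
  have h2 : (2 * (p : ℍ[ℝ])) = ((2 * p : ℝ) : ℍ[ℝ]) := by push_cast; rfl
  rw [h2, div_eq_mul_inv, ← coe_inv]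
  simp only [sq ‖_‖, ← normSq_eq_norm_mul_self, normSq_def', re_add, imI_add, imJ_add, imK_add,
    re_mul, imI_mul, imJ_mul, imK_mul, re_star, imI_star, imJ_star, imK_star, re_coe, imI_coe,
    imJ_coe, imK_coe]
  field_simp
  ring

/-- Completing the square: the vector part of the quadratic expression with real leading
coefficient. -/
lemma im_quadratic_eq {p : ℝ} (hp : p ≠ 0) (Q R X : ℍ[ℝ]) :
    (X * (p : ℍ[ℝ]) * star X + X * Q + R * star X + R * Q / (p : ℍ[ℝ])).im
      = ((X + (star Q + R) / (2 * (p : ℍ[ℝ]))) * (Q - star R)).im := by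
  have h2 : (2 * (p : ℍ[ℝ])) = ((2 * p : ℝ) : ℍ[ℝ]) := by push_cast; rfl
  rw [h2, div_eq_mul_inv, div_eq_mul_inv, ← coe_inv, ← coe_inv]
  ext <;>
  simp only [re_im, imI_im, imJ_im, imK_im, re_add, imI_add, imJ_add, imK_add,
    re_sub, imI_sub, imJ_sub, imK_sub,
    re_mul, imI_mul, imJ_mul, imK_mul, re_star, imI_star, imJ_star, imK_star, re_coe, imI_coe,
    imJ_coe, imK_coe] <;>
  field_simp <;>
  ring

lemma norm_sq_eq_re_sq_add_norm_im_sq (a : ℍ[ℝ]) : ‖a‖ ^ 2 = a.re ^ 2 + ‖a.im‖ ^ 2 := by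
  simp only [sq ‖_‖, ← normSq_eq_norm_mul_self, normSq_def', re_im, imI_im, imJ_im, imK_im]
  ring

/-- A right multiple `Y * D` with prescribed vector part `v` and prescribed `‖Y‖` is determined
up to the sign of its scalar part. -/
lemma norm_sq_eq_and_im_mul_eq_iff {D Y v : ℍ[ℝ]} {r d : ℝ} (hD : D ≠ 0) (hv : v.re = 0)
    (hd : 0 ≤ d) (h : d = r * ‖D‖ ^ 2 - ‖v‖ ^ 2) :
    (‖Y‖ ^ 2 = r ∧ (Y * D).im = v) ↔
      Y = (v + (Real.sqrt d : ℍ[ℝ])) * D⁻¹ ∨ Y = (v - (Real.sqrt d : ℍ[ℝ])) * D⁻¹ := by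
  have hD' : ‖D‖ ^ 2 ≠ 0 := by simpa using hD
  have hs : Real.sqrt d ^ 2 = d := Real.sq_sqrt hd
  have him : v.im = v := by ext <;> simp [hv]
  have hn : ‖Y * D‖ ^ 2 = ‖Y‖ ^ 2 * ‖D‖ ^ 2 := by rw [norm_mul, mul_pow]
  rw [norm_sq_eq_re_sq_add_norm_im_sq (Y * D)] at hn
  rw [eq_mul_inv_iff_mul_eq₀ hD, eq_mul_inv_iff_mul_eq₀ hD]
  have hsplit := re_add_im (Y * D)
  constructor
  · rintro ⟨h1, h2⟩
    rw [h1, h2] at hn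
    have : (Y * D).re ^ 2 = Real.sqrt d ^ 2 := by rw [hs]; linarith
    rcases sq_eq_sq_iff_eq_or_eq_neg.1 this with h3 | h3 <;> rw [h2, h3] at hsplit
    · left; rw [← hsplit, add_comm]
    · right; rw [← hsplit, coe_neg]; abel
  · intro h3
    have key : (Y * D).re ^ 2 = d ∧ (Y * D).im = v := by
      rcases h3 with h3 | h3 <;> rw [h3] <;> simp [hv, hs, him]
    refine ⟨?_, key.2⟩
    rw [key.1, key.2] at hn
    exact mul_right_cancel₀ hD' (by linarith)

end Quaternion

/-- the case `ρ > 0`, `Q ≠ R*`, `Δ ≥ 0` with real `P = p0 ≠ 0`: the solution set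
consists of the two explicit points, which coincide exactly when `Δ = 0`. -/
theorem quadratic_quaternion_real_two_solutions (p0 : ℝ) (hp0 : p0 ≠ 0) (Q R S : ℍ[ℝ])
    (ρ Δ : ℝ) (hρ : ρ = S.re / p0 + ‖Q + star R‖ ^ 2 / (4 * p0 ^ 2))
    (hΔ : Δ = ρ * ‖Q - star R‖ ^ 2 - ‖(S + R * Q / (p0 : ℍ[ℝ])).im‖ ^ 2)
    (hpos : 0 < ρ) (hQR : Q ≠ star R) (hΔ0 : 0 ≤ Δ) :
    {X : ℍ[ℝ] | X * (p0 : ℍ[ℝ]) * star X + X * Q + R * star X = S}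
      = {((S + R * Q / (p0 : ℍ[ℝ])).im + (Real.sqrt Δ : ℍ[ℝ])) * (Q - star R)⁻¹
            - (star Q + R) / (2 * (p0 : ℍ[ℝ])),
         ((S + R * Q / (p0 : ℍ[ℝ])).im - (Real.sqrt Δ : ℍ[ℝ])) * (Q - star R)⁻¹
            - (star Q + R) / (2 * (p0 : ℍ[ℝ]))} ∧
    (0 < Δ →
      ((S + R * Q / (p0 : ℍ[ℝ])).im + (Real.sqrt Δ : ℍ[ℝ])) * (Q - star R)⁻¹
          - (star Q + R) / (2 * (p0 : ℍ[ℝ]))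
        ≠ ((S + R * Q / (p0 : ℍ[ℝ])).im - (Real.sqrt Δ : ℍ[ℝ])) * (Q - star R)⁻¹
          - (star Q + R) / (2 * (p0 : ℍ[ℝ]))) ∧
    (Δ = 0 →
      ((S + R * Q / (p0 : ℍ[ℝ])).im + (Real.sqrt Δ : ℍ[ℝ])) * (Q - star R)⁻¹
          - (star Q + R) / (2 * (p0 : ℍ[ℝ]))
        = ((S + R * Q / (p0 : ℍ[ℝ])).im - (Real.sqrt Δ : ℍ[ℝ])) * (Q - star R)⁻¹
          - (star Q + R) / (2 * (p0 : ℍ[ℝ]))) := by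
  have hD : Q - star R ≠ 0 := sub_ne_zero.2 hQR
  refine ⟨?_, fun hlt heq => ?_, fun h0 => by simp [h0]⟩
  · ext X
    simp only [Set.mem_ofPred_eq, Set.mem_insert_iff, Set.mem_singleton_iff, eq_sub_iff_add_eq]
    rw [← norm_sq_eq_and_im_mul_eq_iff hD (re_im _) hΔ0 hΔ, ← im_quadratic_eq hp0]
    have hre := re_quadratic_eq hp0 Q R X
    constructor
    · intro h
      rw [h] at hre ⊢
      refine ⟨?_, rfl⟩
      rw [hρ, hre]
      field_simp
      ring
    · rintro ⟨h1, h2⟩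
      rw [h1, hρ] at hre
      have hre' : (X * (p0 : ℍ[ℝ]) * star X + X * Q + R * star X).re = S.re := by
        rw [hre]
        field_simp
        ring
      rw [im_add _ (R * Q / _), im_add S, add_left_inj] at h2
      rw [← re_add_im S, ← hre', ← h2, re_add_im]
  · have h1 := mul_right_cancel₀ (inv_ne_zero hD) (sub_left_injective heq)
    have h2 := congrArg (fun a : ℍ[ℝ] => a.re) h1
    simp only [re_add, re_sub, re_coe] at h2
    linarith [Real.sqrt_pos.2 hlt]
end

section
/- Let P = p0 ∈ ℝ with p0 ≠ 0 and let Q, R, S ∈ ℍ. Set ρ = scal(S)/p0 + |Q + R*|²/(4p0²) and Δ = ρ|Q − R*|² − |vect(S + R Q / p0)|², and suppose ρ > 0, Q ≠ R*, and Δ < 0. Then the equation X P X* + X Q + R X* = S has no solution X ∈ ℍ. -/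
open Quaternion

theorem Quaternion.norm_sq_eq_sum_sq (a : ℍ[ℝ]) :
    ‖a‖ ^ 2 = a.re ^ 2 + a.imI ^ 2 + a.imJ ^ 2 + a.imK ^ 2 := by
  rw [sq, ← Quaternion.normSq_eq_norm_mul_self, Quaternion.normSq_def']

theorem Quaternion.norm_im_sq_le (a : ℍ[ℝ]) : ‖a.im‖ ^ 2 ≤ ‖a‖ ^ 2 := by
  rw [norm_sq_eq_sum_sq, norm_sq_eq_sum_sq]
  simp only [re_im, imI_im, imJ_im, imK_im]
  nlinarith [sq_nonneg a.re]

/-- the case `ρ > 0`, `Q ≠ R*`, `Δ < 0` with real `P = p0 ≠ 0`: no solution. -/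
theorem quadratic_quaternion_real_no_solution_of_delta_neg (p0 : ℝ) (hp0 : p0 ≠ 0)
    (Q R S : ℍ[ℝ]) (ρ Δ : ℝ) (hρ : ρ = S.re / p0 + ‖Q + star R‖ ^ 2 / (4 * p0 ^ 2))
    (hΔ : Δ = ρ * ‖Q - star R‖ ^ 2 - ‖(S + R * Q / (p0 : ℍ[ℝ])).im‖ ^ 2)
    (hpos : 0 < ρ) (hQR : Q ≠ star R) (hΔneg : Δ < 0) :
    ¬ ∃ X : ℍ[ℝ], X * (p0 : ℍ[ℝ]) * star X + X * Q + R * star X = S := by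
  rintro ⟨X, rfl⟩
  -- Completing the square: `Z` has norm `√ρ`, and `Z (Q - R*)` has the vector part in `Δ`.
  set Z : ℍ[ℝ] := X + ((2 * p0)⁻¹ : ℝ) • star (Q + star R) with hZ
  have norm_Z : ‖Z‖ ^ 2 = ρ := by
    rw [hρ, norm_sq_eq_sum_sq, norm_sq_eq_sum_sq]
    simp [hZ]
    field_simp
    ring
  have im_Z : (X * (p0 : ℍ[ℝ]) * star X + X * Q + R * star X + R * Q / (p0 : ℍ[ℝ])).im =
      (Z * (Q - star R)).im := by
    rw [div_eq_mul_inv, ← Quaternion.coe_inv]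
    ext <;> simp [hZ, -Quaternion.coe_inv] <;> field_simp <;> ring
  have h := norm_im_sq_le (Z * (Q - star R))
  rw [norm_mul, mul_pow, norm_Z, ← im_Z] at h
  linarith
end

section
/- Let p and s be nonzero pure vector quaternions. Then the set of all V ∈ ℍ satisfying V p̂ − ŝ V = 0 is exactly the 2-plane Π_{p,s}. -/
open Quaternion
open scoped InnerProductSpace Classical

/-- The 2-plane `ℂ_u = ℝ + ℝ u` spanned by `1` and `u` in the quaternions. -/
def complexPlane (u : ℍ[ℝ]) : Set ℍ[ℝ] :=
  {z : ℍ[ℝ] | ∃ a b : ℝ, z = (a : ℍ[ℝ]) + (b : ℍ[ℝ]) * u}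

/-- The 2-plane `Π_{p,s}` associated to nonzero pure vector quaternions `p, s`:
if `ŝ ≠ −p̂` it is `u_{p,s} ℂ_{p̂}` with `u_{p,s} = (p̂ + ŝ)/|p̂ + ŝ|`; if `ŝ = −p̂`
it is the 2-plane of pure vector quaternions orthogonal to `p̂`. -/
noncomputable def PiPlane (p s : ℍ[ℝ]) : Set ℍ[ℝ] :=
  if ‖s‖⁻¹ • s = -(‖p‖⁻¹ • p) then
    {v : ℍ[ℝ] | v.re = 0 ∧ ⟪v, ‖p‖⁻¹ • p⟫_ℝ = 0}
  else
    (fun z => (‖‖p‖⁻¹ • p + ‖s‖⁻¹ • s‖⁻¹ • (‖p‖⁻¹ • p + ‖s‖⁻¹ • s)) * z) ''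
      complexPlane (‖p‖⁻¹ • p)

/-- A unit pure quaternion squares to `-1`. -/
theorem mul_self_unit_pure {p : ℍ[ℝ]} (hp : p.re = 0) (hp0 : p ≠ 0) :
    (‖p‖⁻¹ • p) * (‖p‖⁻¹ • p) = -1 := by
  have hn : ‖p‖ ≠ 0 := norm_ne_zero_iff.mpr hp0
  have hstar : star p = -p := by ext <;> simp [hp]
  have hpp : p * p = -((‖p‖ * ‖p‖ : ℝ) : ℍ[ℝ]) := by
    have h := Quaternion.self_mul_star p
    rw [hstar, Quaternion.normSq_eq_norm_mul_self] at h
    rw [← h, mul_neg, neg_neg]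
  rw [smul_mul_smul_comm, hpp, smul_neg, ← Quaternion.coe_smul, smul_eq_mul]
  have : ‖p‖⁻¹ * ‖p‖⁻¹ * (‖p‖ * ‖p‖) = 1 := by field_simp
  rw [this, Quaternion.coe_one]

/-- The centralizer of a pure square root of `-1` is the plane it spans with `1`. -/
theorem mem_complexPlane_iff_commute {P z : ℍ[ℝ]} (hP : P.re = 0) (hPP : P * P = -1) :
    z ∈ complexPlane P ↔ z * P = P * z := by
  constructor
  · rintro ⟨a, b, rfl⟩
    rw [add_mul, mul_add, Quaternion.coe_commutes a P, mul_assoc, ← mul_assoc P,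
      ← Quaternion.coe_commutes b P, mul_assoc]
  · intro h
    have h0 := congrArg QuaternionAlgebra.re hPP
    have h1 := congrArg QuaternionAlgebra.imI h
    have h2 := congrArg QuaternionAlgebra.imJ h
    have h3 := congrArg QuaternionAlgebra.imK h
    simp [hP] at h0 h1 h2 h3
    refine ⟨z.re, z.imI * P.imI + z.imJ * P.imJ + z.imK * P.imK, ?_⟩
    ext
    · simp [hP]
    · simp
      linear_combination z.imI * h0 - P.imK / 2 * h2 + P.imJ / 2 * h3
    · simp
      linear_combination z.imJ * h0 + P.imK / 2 * h1 - P.imI / 2 * h3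
    · simp
      linear_combination z.imK * h0 - P.imJ / 2 * h1 + P.imI / 2 * h2

/-- The quaternions anticommuting with a pure square root of `-1` are the pure quaternions
orthogonal to it. -/
theorem anticommute_iff_re_eq_zero_and_inner_eq_zero {P V : ℍ[ℝ]} (hP : P.re = 0)
    (hPP : P * P = -1) :
    V * P + P * V = 0 ↔ V.re = 0 ∧ ⟪V, P⟫_ℝ = 0 := by
  have h0 := congrArg QuaternionAlgebra.re hPP
  simp [hP] at h0
  rw [Quaternion.inner_def]
  constructor
  · intro h
    have hr := congrArg QuaternionAlgebra.re h
    have h1 := congrArg QuaternionAlgebra.imI h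
    have h2 := congrArg QuaternionAlgebra.imJ h
    have h3 := congrArg QuaternionAlgebra.imK h
    simp [hP] at hr h1 h2 h3 ⊢
    constructor
    · linear_combination V.re * h0 + P.imI / 2 * h1 + P.imJ / 2 * h2 + P.imK / 2 * h3
    · linear_combination (-1 / 2) * hr
  · rintro ⟨hV, hi⟩
    simp [hP, hV] at hi
    ext <;> simp [hP, hV]
    · linear_combination (-2) * hi
    all_goals ring

/-- for nonzero pure vector quaternions `p, s`, the solution set of
`V p̂ − ŝ V = 0` is exactly the 2-plane `Π_{p,s}`. -/
theorem bisector_eq_PiPlane (p s : ℍ[ℝ]) (hp : p.re = 0) (hs : s.re = 0)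
    (hp0 : p ≠ 0) (hs0 : s ≠ 0) :
    {V : ℍ[ℝ] | V * (‖p‖⁻¹ • p) - (‖s‖⁻¹ • s) * V = 0} = PiPlane p s := by
  have hPP := mul_self_unit_pure hp hp0
  have hSS := mul_self_unit_pure hs hs0
  have hP : (‖p‖⁻¹ • p).re = 0 := by simp [hp]
  unfold PiPlane
  generalize ‖p‖⁻¹ • p = P at *
  generalize ‖s‖⁻¹ • s = S at *
  split_ifs with h
  · subst h
    ext V
    simpa only [Set.mem_ofPred_eq, neg_mul, sub_neg_eq_add] using
      anticommute_iff_re_eq_zero_and_inner_eq_zero hP hPP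
  · have hw : P + S ≠ 0 := fun h0 => h (eq_neg_of_add_eq_zero_right h0)
    set u := ‖P + S‖⁻¹ • (P + S) with hu
    have hu0 : u ≠ 0 := smul_ne_zero (inv_ne_zero (norm_ne_zero_iff.mpr hw)) hw
    have hcomm : u * P = S * u := by
      rw [hu, smul_mul_assoc, mul_smul_comm, add_mul, mul_add, hPP, hSS, add_comm (-1)]
    ext V
    rw [Set.mem_ofPred_eq, sub_eq_zero]
    constructor
    · intro hV
      refine ⟨u⁻¹ * V, (mem_complexPlane_iff_commute hP hPP).mpr ?_,
        mul_inv_cancel_left₀ hu0 V⟩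
      apply mul_left_cancel₀ hu0
      rw [mul_assoc, mul_inv_cancel_left₀ hu0, ← mul_assoc u P, hcomm, mul_assoc S,
        mul_inv_cancel_left₀ hu0, hV]
    · rintro ⟨z, hz, rfl⟩
      have hz' := (mem_complexPlane_iff_commute hP hPP).mp hz
      simp only
      rw [mul_assoc, hz', ← mul_assoc, hcomm, mul_assoc]
end

section
/- Let p and s be nonzero pure vector quaternions. Then the set of solutions X ∈ ℍ of the equation X p X* = s is exactly the circle C_{p,s} = { X ∈ Π_{p,s} : |X| = √(|s|/|p|) }, i.e., the circle in the 2-plane Π_{p,s} with center 0 and radius √(|s|/|p|). -/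
open Quaternion
open scoped InnerProductSpace Classical

theorem Quaternion.mul_self_eq_neg_one_of_unit {u : ℍ[ℝ]} (hu : u.re = 0) (hn : ‖u‖ = 1) :
    u * u = -1 := by
  have h := Quaternion.self_mul_star u
  rw [Quaternion.star_eq_neg.mpr hu, Quaternion.normSq_eq_norm_mul_self, hn] at h
  rw [← neg_eq_iff_eq_neg, ← mul_neg, h]
  simp

/-- The plane `ℂ_u` of a unit pure vector quaternion `u` is the commutant of `u`. -/
theorem mem_complexPlane_iff_commute_s8 {u : ℍ[ℝ]} (hu : u.re = 0) (hn : ‖u‖ = 1) (z : ℍ[ℝ]) :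
    z ∈ complexPlane u ↔ z * u = u * z := by
  constructor
  · rintro ⟨a, b, rfl⟩
    rw [add_mul, mul_add, Quaternion.coe_commutes a u, Quaternion.coe_commutes b u, mul_assoc,
      Quaternion.coe_commutes b u]
  · intro h
    have hsq : u.imI ^ 2 + u.imJ ^ 2 + u.imK ^ 2 = 1 := by
      have h1 := Quaternion.normSq_eq_norm_mul_self u
      rw [Quaternion.normSq_def', hn, hu] at h1
      linarith
    have hI := congrArg QuaternionAlgebra.imI h
    have hJ := congrArg QuaternionAlgebra.imJ h
    have hK := congrArg QuaternionAlgebra.imK h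
    simp only [Quaternion.imI_mul, Quaternion.imJ_mul, Quaternion.imK_mul, hu] at hI hJ hK
    refine ⟨z.re, z.imI * u.imI + z.imJ * u.imJ + z.imK * u.imK, ?_⟩
    ext
    · simp [hu]
    · simp
      linear_combination (-z.imI) * hsq + u.imJ / 2 * hK - u.imK / 2 * hJ
    · simp
      linear_combination (-z.imJ) * hsq + u.imK / 2 * hI - u.imI / 2 * hK
    · simp
      linear_combination (-z.imK) * hsq + u.imI / 2 * hJ - u.imJ / 2 * hI

/-- A quaternion anticommutes with a nonzero pure vector quaternion `u` exactly when it is a pure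
vector quaternion orthogonal to `u`. -/
theorem Quaternion.mul_eq_neg_mul_iff {u : ℍ[ℝ]} (hu : u.re = 0) (hu0 : u ≠ 0) (v : ℍ[ℝ]) :
    v * u = -u * v ↔ v.re = 0 ∧ ⟪v, u⟫_ℝ = 0 := by
  rw [Quaternion.inner_def]
  constructor
  · intro h
    have hR := congrArg QuaternionAlgebra.re h
    have hI := congrArg QuaternionAlgebra.imI h
    have hJ := congrArg QuaternionAlgebra.imJ h
    have hK := congrArg QuaternionAlgebra.imK h
    simp [hu] at hR hI hJ hK
    constructor
    · by_contra hv
      apply hu0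
      ext
      · simpa using hu
      · have h0 : v.re * u.imI = 0 := by linarith
        simpa [hv] using h0
      · have h0 : v.re * u.imJ = 0 := by linarith
        simpa [hv] using h0
      · have h0 : v.re * u.imK = 0 := by linarith
        simpa [hv] using h0
    · simp [hu]
      linarith
  · rintro ⟨hv, h⟩
    simp [hu, hv] at h
    ext <;> simp [hu, hv] <;> linarith

/-- The plane `Π_{p,s}` consists of the quaternions intertwining `p̂` and `ŝ`. -/
theorem mem_PiPlane_iff {p s : ℍ[ℝ]} (hp : p.re = 0) (hs : s.re = 0) (hp0 : p ≠ 0) (hs0 : s ≠ 0)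
    (X : ℍ[ℝ]) : X ∈ PiPlane p s ↔ X * (‖p‖⁻¹ • p) = ‖s‖⁻¹ • s * X := by
  have hP : (‖p‖⁻¹ • p).re = 0 := by simp [hp]
  have hS : (‖s‖⁻¹ • s).re = 0 := by simp [hs]
  have hPn : ‖‖p‖⁻¹ • p‖ = 1 := norm_smul_inv_norm (𝕜 := ℝ) hp0
  have hSn : ‖‖s‖⁻¹ • s‖ = 1 := norm_smul_inv_norm (𝕜 := ℝ) hs0
  unfold PiPlane
  generalize ‖p‖⁻¹ • p = P at *
  generalize ‖s‖⁻¹ • s = S at *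
  have hP0 : P ≠ 0 := by
    rintro rfl
    simp at hPn
  split_ifs with h
  · rw [h, Quaternion.mul_eq_neg_mul_iff hP hP0]
    rfl
  · have hQ : P + S ≠ 0 := fun h0 => h (eq_neg_of_add_eq_zero_right h0)
    have hu0 : ‖P + S‖⁻¹ • (P + S) ≠ 0 :=
      smul_ne_zero (inv_ne_zero (norm_ne_zero_iff.mpr hQ)) hQ
    have hu : ‖P + S‖⁻¹ • (P + S) * P = S * (‖P + S‖⁻¹ • (P + S)) := by
      rw [smul_mul_assoc, mul_smul_comm, add_mul, mul_add,
        Quaternion.mul_self_eq_neg_one_of_unit hP hPn,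
        Quaternion.mul_self_eq_neg_one_of_unit hS hSn, add_comm (-1)]
    generalize ‖P + S‖⁻¹ • (P + S) = u at *
    have key (z : ℍ[ℝ]) : z ∈ complexPlane P ↔ u * z * P = S * (u * z) := by
      rw [mem_complexPlane_iff_commute_s8 hP hPn, ← mul_assoc S, ← hu, mul_assoc, mul_assoc,
        mul_right_inj' hu0]
    constructor
    · rintro ⟨z, hz, rfl⟩
      exact (key z).mp hz
    · intro hX
      refine ⟨u⁻¹ * X, (key _).mpr ?_, mul_inv_cancel_left₀ hu0 X⟩
      rwa [mul_inv_cancel_left₀ hu0]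

/-- for nonzero pure vector quaternions `p, s`, the solution set of
`X p X* = s` is the circle of radius `√(|s|/|p|)` centered at `0` in `Π_{p,s}`. -/
theorem solutions_eq_circle (p s : ℍ[ℝ]) (hp : p.re = 0) (hs : s.re = 0)
    (hp0 : p ≠ 0) (hs0 : s ≠ 0) :
    {X : ℍ[ℝ] | X * p * star X = s}
      = {X : ℍ[ℝ] | X ∈ PiPlane p s ∧ ‖X‖ = Real.sqrt (‖s‖ / ‖p‖)} := by
  have hpn : ‖p‖ ≠ 0 := norm_ne_zero_iff.mpr hp0
  have hsn : ‖s‖ ≠ 0 := norm_ne_zero_iff.mpr hs0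
  ext X
  simp only [Set.mem_ofPred_eq]
  rw [mem_PiPlane_iff hp hs hp0 hs0, mul_smul_comm, smul_mul_assoc,
    eq_comm (a := ‖X‖), Real.sqrt_eq_iff_mul_self_eq (by positivity) (norm_nonneg X)]
  have hXX : star X * X = ((‖X‖ * ‖X‖ : ℝ) : ℍ[ℝ]) := by
    rw [Quaternion.star_mul_self, Quaternion.normSq_eq_norm_mul_self]
  have hXX' : X * star X = ((‖X‖ * ‖X‖ : ℝ) : ℍ[ℝ]) := by
    rw [Quaternion.self_mul_star, Quaternion.normSq_eq_norm_mul_self]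
  constructor
  · intro h
    have hn : ‖X‖ * ‖X‖ = ‖s‖ / ‖p‖ := by
      rw [eq_div_iff hpn, ← h, norm_mul, norm_mul, Quaternion.norm_star]
      ring
    refine ⟨?_, hn.symm⟩
    rw [← h, mul_assoc (X * p), hXX, hn, h, Quaternion.mul_coe_eq_smul, smul_smul]
    congr 1
    field_simp
  · rintro ⟨h, hn⟩
    have hXp : X * p = (‖p‖ / ‖s‖) • (s * X) := by
      rw [div_eq_mul_inv, mul_smul, ← h, smul_inv_smul₀ hpn]
    rw [hXp, smul_mul_assoc, mul_assoc, hXX', ← hn, Quaternion.mul_coe_eq_smul, smul_smul,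
      div_mul_div_cancel₀ hsn, div_self hpn, one_smul]
end

section
/- Let P, Q, R, S ∈ ℍ with P ∉ ℝ, and define R̃ = (Q*P − RP*)(P − P*)^{-1} and S̃ = S + (Q*PR* + RP*Q)/|P − P*|² + R(P* − P)Q/|P − P*|² − Q*P*Q/|P − P*|² − RP*R*/|P − P*|². Then X ∈ ℍ satisfies X P X* + X Q + R X* = S if and only if the quaternion Z = X + (R − Q*)(P − P*)^{-1} satisfies Z P Z* + Z R̃* + R̃ Z* = S̃. -/
open Quaternion

/-- for `P ∉ ℝ`, the substitution `Z = X + (R − Q*)(P − P*)⁻¹` transforms the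
equation `X P X* + X Q + R X* = S` into `Z P Z* + Z R̃* + R̃ Z* = S̃`. -/
theorem quadratic_quaternion_nonreal_reduction (P Q R S : ℍ[ℝ]) (hP : P.im ≠ 0)
    (Rt St : ℍ[ℝ])
    (hRt : Rt = (star Q * P - R * star P) * (P - star P)⁻¹)
    (hSt : St = S
      + (star Q * P * star R + R * star P * Q) / ((‖P - star P‖ ^ 2 : ℝ) : ℍ[ℝ])
      + R * (star P - P) * Q / ((‖P - star P‖ ^ 2 : ℝ) : ℍ[ℝ])
      - star Q * star P * Q / ((‖P - star P‖ ^ 2 : ℝ) : ℍ[ℝ])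
      - R * star P * star R / ((‖P - star P‖ ^ 2 : ℝ) : ℍ[ℝ]))
    (X : ℍ[ℝ]) :
    X * P * star X + X * Q + R * star X = S ↔
      (X + (R - star Q) * (P - star P)⁻¹) * P * star (X + (R - star Q) * (P - star P)⁻¹)
        + (X + (R - star Q) * (P - star P)⁻¹) * star Rt
        + Rt * star (X + (R - star Q) * (P - star P)⁻¹) = St := by
  -- all inverses are expressed through `V = (P - P*)⁻¹`, which commutes with `P`
  have hW : P - star P ≠ 0 := by
    intro h
    apply hP
    ext
    · rfl
    · have := congrArg QuaternionAlgebra.imI h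
      simp at this ⊢; linarith
    · have := congrArg QuaternionAlgebra.imJ h
      simp at this ⊢; linarith
    · have := congrArg QuaternionAlgebra.imK h
      simp at this ⊢; linarith
  have hdiv (T : ℍ[ℝ]) : T / ((‖P - star P‖ ^ 2 : ℝ) : ℍ[ℝ]) = (‖P - star P‖ ^ 2)⁻¹ • T := by
    rw [div_eq_mul_inv, ← Quaternion.coe_inv, Quaternion.mul_coe_eq_smul]
  have hsW : star (P - star P) = -(P - star P) := by simp
  simp only [hdiv] at hSt
  have hV : (P - star P)⁻¹ = (‖P - star P‖ ^ 2)⁻¹ • (star P - P) := by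
    rw [Quaternion.inv_def, Quaternion.normSq_eq_norm_mul_self, ← sq, hsW, neg_sub]
  generalize hVdef : (P - star P)⁻¹ = V at *
  generalize (‖P - star P‖ ^ 2)⁻¹ = c at *
  have hVW : V * (P - star P) = 1 := hVdef ▸ inv_mul_cancel₀ hW
  have hcomm : P * V = V * P := by
    rw [hV, mul_smul_comm, smul_mul_assoc, mul_sub, sub_mul, Quaternion.self_mul_star,
      Quaternion.star_mul_self]
  have hsV : star V = -V := by
    rw [hV, Quaternion.star_smul, star_sub, star_star, ← smul_neg, neg_sub]
  have hcomm' : V * star P = star P * V := by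
    simpa [hsV] using congrArg star hcomm
  have hVV : V * V = -(c • 1) := by
    nth_rewrite 2 [hV]
    rw [mul_smul_comm, ← neg_sub P, mul_neg, hVW, smul_neg]
  have hsA : star ((R - star Q) * V) = V * (Q - star R) := by
    rw [star_mul, hsV, star_sub, star_star]
    noncomm_ring
  have hleft : (R - star Q) * V * P + Rt = R := by
    calc (R - star Q) * V * P + Rt
        = (R - star Q) * (V * P) + (star Q * P - R * star P) * V := by rw [hRt, mul_assoc]
      _ = (R - star Q) * (V * P) + (star Q * (P * V) - R * (star P * V)) := by noncomm_ring
      _ = R * (V * (P - star P)) := by rw [hcomm, ← hcomm']; noncomm_ring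
      _ = R := by rw [hVW, mul_one]
  have hright : P * star ((R - star Q) * V) + star Rt = Q := by
    have hstar : star Rt = -(V * (star P * Q - P * star R)) := by
      rw [hRt]; simp [hsV]
    calc P * star ((R - star Q) * V) + star Rt
        = P * V * (Q - star R) - V * (star P * Q - P * star R) := by
          rw [hsA, hstar]; noncomm_ring
      _ = V * (P - star P) * Q := by rw [hcomm]; noncomm_ring
      _ = Q := by rw [hVW, one_mul]
  have hconst : (R - star Q) * V * Q + Rt * star ((R - star Q) * V) = St - S := by
    have h1 : Rt * star ((R - star Q) * V)
        = -(c • ((star Q * P - R * star P) * (Q - star R))) := by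
      calc Rt * star ((R - star Q) * V)
          = (star Q * P - R * star P) * (V * V) * (Q - star R) := by
            rw [hsA, hRt]; noncomm_ring
        _ = _ := by rw [hVV]; simp
    have h2 : (R - star Q) * V * Q = c • ((R - star Q) * (star P - P) * Q) := by
      rw [hV, mul_smul_comm, smul_mul_assoc]
    rw [h1, h2, hSt, ← smul_neg, ← smul_add]
    have h3 (a b d e s : ℍ[ℝ]) :
        s + c • a + c • b - c • d - c • e - s = c • (a + b - d - e) := by
      simp only [smul_add, smul_sub]; abel
    rw [h3]
    congr 1
    noncomm_ring
  generalize (R - star Q) * V = A at *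
  have key : (X + A) * P * star (X + A) + (X + A) * star Rt + Rt * star (X + A)
      = X * P * star X + X * Q + R * star X + (St - S) := by
    calc _ = X * P * star X + X * (P * star A + star Rt) + (A * P + Rt) * star X
          + (A * (P * star A + star Rt) + Rt * star A) := by rw [star_add]; noncomm_ring
      _ = _ := by rw [hleft, hright, hconst]
  rw [key, ← sub_eq_zero, ← sub_eq_zero (b := St)]
  abel_nf
end

section
/- Let P, Q, R, S ∈ ℍ with P ∉ ℝ, and define S̃ = S + (Q*PR* + RP*Q)/|P − P*|² + R(P* − P)Q/|P − P*|² − Q*P*Q/|P − P*|² − RP*R*/|P − P*|². If S̃ = 0, then X = −(R − Q*)(P − P*)^{-1} is the unique solution in ℍ of the equation X P X* + X Q + R X* = S. -/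
open Quaternion

theorem Quaternion.sub_star_ne_zero_of_im_ne_zero {P : ℍ[ℝ]} (hP : P.im ≠ 0) :
    P - star P ≠ 0 := by
  intro h
  apply hP
  rw [Quaternion.star_eq_self.1 (sub_eq_zero.1 h).symm, Quaternion.im_coe]

/-- If `Y P Y*` is real for a non-real `P`, then `Y` vanishes. -/
theorem Quaternion.eq_zero_of_isSelfAdjoint_mul_mul_star {P Y : ℍ[ℝ]} (hP : P.im ≠ 0)
    (h : IsSelfAdjoint (Y * P * star Y)) : Y = 0 := by
  have hD : Y * (P - star P) * star Y = 0 := by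
    rw [mul_sub, sub_mul, sub_eq_zero, ← h.star_eq]
    simp [mul_assoc]
  simpa [Quaternion.sub_star_ne_zero_of_im_ne_zero hP] using hD

/-- The value of `X ↦ X P X* + X Q + R X*` at `X = k (R - Q*) (P - P*)`, where
`k = |P - P*|⁻²`. -/
theorem Quaternion.quadratic_eval_center (P Q R : ℍ[ℝ]) {k : ℝ}
    (hk : k • ((P - star P) * (P - star P)) = -1) :
    (k • ((R - star Q) * (P - star P))) * P * star (k • ((R - star Q) * (P - star P)))
        + (k • ((R - star Q) * (P - star P))) * Q
        + R * star (k • ((R - star Q) * (P - star P)))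
      = k • (R * star P * star R + star Q * star P * Q - star Q * P * star R
        - R * star P * Q - R * (star P - P) * Q) := by
  have hstar : star (k • ((R - star Q) * (P - star P)))
      = -(k • ((P - star P) * (star R - Q))) := by
    rw [star_smul, star_mul, star_sub, star_sub, star_star, star_star, ← neg_sub P, neg_mul,
      smul_neg]
  have hcomm : (P - star P) * P = P * (P - star P) := by
    rw [sub_mul, mul_sub, star_comm_self' P]
  have hDPD : k • ((P - star P) * P * (P - star P)) = -P := by
    rw [hcomm, mul_assoc, ← mul_smul_comm, hk, mul_neg_one]
  have hquad : (k • ((R - star Q) * (P - star P))) * P * (k • ((P - star P) * (star R - Q)))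
      = -(k • ((R - star Q) * P * (star R - Q))) := by
    calc _ = k • ((R - star Q) * (k • ((P - star P) * P * (P - star P))) * (star R - Q)) := by
          simp only [smul_mul_assoc, mul_smul_comm, mul_assoc]
      _ = _ := by rw [hDPD, mul_neg, neg_mul, smul_neg]
  rw [hstar, mul_neg, hquad, neg_neg, smul_mul_assoc, mul_neg, mul_smul_comm, ← smul_neg,
    ← smul_add, ← smul_add]
  congr 1
  noncomm_ring

/-- for `P ∉ ℝ`, if `S̃ = 0` then `X = −(R − Q*)(P − P*)⁻¹` is the unique
solution of `X P X* + X Q + R X* = S`. -/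
theorem quadratic_quaternion_nonreal_unique_solution (P Q R S : ℍ[ℝ]) (hP : P.im ≠ 0)
    (St : ℍ[ℝ])
    (hSt : St = S
      + (star Q * P * star R + R * star P * Q) / ((‖P - star P‖ ^ 2 : ℝ) : ℍ[ℝ])
      + R * (star P - P) * Q / ((‖P - star P‖ ^ 2 : ℝ) : ℍ[ℝ])
      - star Q * star P * Q / ((‖P - star P‖ ^ 2 : ℝ) : ℍ[ℝ])
      - R * star P * star R / ((‖P - star P‖ ^ 2 : ℝ) : ℍ[ℝ]))
    (hS0 : St = 0) :
    {X : ℍ[ℝ] | X * P * star X + X * Q + R * star X = S}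
      = {-(R - star Q) * (P - star P)⁻¹} := by
  set D := P - star P with hD
  have hD0 : D ≠ 0 := Quaternion.sub_star_ne_zero_of_im_ne_zero hP
  have hDstar : star D = -D := by simp [hD]
  set c : ℝ := ‖D‖ ^ 2 with hc
  have hc0 : c ≠ 0 := by positivity
  have hDD : D * D = -(c : ℍ[ℝ]) := by
    have h := Quaternion.self_mul_star D
    rw [hDstar, Quaternion.normSq_eq_norm_mul_self, ← sq, ← hc] at h
    rw [← h, mul_neg, neg_neg]
  have hk : c⁻¹ • (D * D) = -1 := by
    rw [hDD, smul_neg, Quaternion.smul_coe, inv_mul_cancel₀ hc0, Quaternion.coe_one]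
  have hinv : D⁻¹ = -(c⁻¹ • D) := by
    refine inv_eq_of_mul_eq_one_right ?_
    rw [mul_neg, mul_smul_comm, hk, neg_neg]
  have hX₀ : -(R - star Q) * D⁻¹ = c⁻¹ • ((R - star Q) * D) := by
    rw [hinv, neg_mul_neg, mul_smul_comm]
  have hdiv (A : ℍ[ℝ]) : A / (c : ℍ[ℝ]) = c⁻¹ • A := by
    rw [div_eq_mul_inv, ← Quaternion.coe_inv, Quaternion.mul_coe_eq_smul]
  have hS : S = c⁻¹ • (R * star P * star R + star Q * star P * Q - star Q * P * star R
      - R * star P * Q - R * (star P - P) * Q) := by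
    rw [hS0] at hSt
    simp only [hdiv] at hSt
    rw [← sub_eq_zero, hSt]
    module
  have hval := Quaternion.quadratic_eval_center P Q R hk
  rw [← hS, ← hD, ← hX₀] at hval
  generalize hX₀def : -(R - star Q) * D⁻¹ = X₀ at hval ⊢
  have hX₀D : X₀ * D = -(R - star Q) := by
    rw [← hX₀def, mul_assoc, inv_mul_cancel₀ hD0, mul_one]
  have hW : star (P * star X₀ + Q) = X₀ * P + R := by
    have : X₀ * P - X₀ * star P = -(R - star Q) := by rw [← mul_sub, ← hD, hX₀D]
    rw [star_add, star_mul, star_star, ← sub_eq_zero]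
    rw [← sub_eq_zero] at this
    rw [← neg_eq_zero, ← this]
    abel
  ext X
  simp only [Set.mem_ofPred_eq, Set.mem_singleton_iff]
  refine ⟨fun hX => ?_, fun hX => hX ▸ hval⟩
  rw [← sub_eq_zero]
  apply Quaternion.eq_zero_of_isSelfAdjoint_mul_mul_star hP
  have hY : (X - X₀) * P * star (X - X₀)
      = -((X - X₀) * (P * star X₀ + Q) + star ((X - X₀) * (P * star X₀ + Q))) := by
    rw [star_mul, hW, ← sub_eq_zero, ← sub_eq_zero.2 (hX.trans hval.symm), star_sub]
    noncomm_ring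
  rw [hY]
  exact (IsSelfAdjoint.add_star_self _).neg
end

section
/- Let P, Q, R, S ∈ ℍ with P ∉ ℝ, and define S̃ = S + (Q*PR* + RP*Q)/|P − P*|² + R(P* − P)Q/|P − P*|² − Q*P*Q/|P − P*|² − RP*R*/|P − P*|². If S̃ is a nonzero real number, then the equation X P X* + X Q + R X* = S has no solution in ℍ. -/
open Quaternion

/-- Completing the square: a translation by `(Q⋆ - R) * W`, where `W = k • (P - P⋆)`, turns the
quadratic expression `X P X⋆ + X Q + R X⋆` into `Y P Y⋆` plus a self-adjoint term. -/
lemma quadratic_complete_square (P Q R X W : ℍ[ℝ]) (k : ℝ)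
    (hW : W = k • (P - star P)) (hWPW : W * P * W = -(k • P)) :
    X * P * star X + X * Q + R * star X
        + k • (star Q * P * star R + R * star P * Q) + k • (R * (star P - P) * Q)
        - k • (star Q * star P * Q) - k • (R * star P * star R)
      = (X + (star Q - R) * W) * P * (star X - W * (Q - star R))
        + (X + (star Q - R) * W) * (P * W * (Q - star R) + Q)
        + (R - (star Q - R) * W * P) * (star X - W * (Q - star R)) := by
  have hexp : (X + (star Q - R) * W) * P * (star X - W * (Q - star R))
        + (X + (star Q - R) * W) * (P * W * (Q - star R) + Q)
        + (R - (star Q - R) * W * P) * (star X - W * (Q - star R))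
      = X * P * star X + X * Q + R * star X
        + (star Q - R) * (W * P * W) * (Q - star R)
        + (star Q - R) * W * Q - R * W * (Q - star R) := by
    noncomm_ring
  rw [hexp, hWPW, hW]
  simp only [mul_sub, sub_mul, mul_neg, neg_mul, smul_sub, smul_add, mul_smul_comm, smul_mul_assoc]
  abel

/-- A quaternion minus its conjugate squares to minus its squared norm. -/
lemma sub_star_mul_self (P : ℍ[ℝ]) :
    (P - star P) * (P - star P) = -(((‖P - star P‖ ^ 2 : ℝ)) : ℍ[ℝ]) := by
  have h : star (P - star P) = -(P - star P) := by simp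
  have h2 := Quaternion.self_mul_star (P - star P)
  rw [h, mul_neg, Quaternion.normSq_eq_norm_mul_self, ← sq ‖P - star P‖] at h2
  rw [← h2, neg_neg]

/-- for `P ∉ ℝ`, if `S̃` is a nonzero real number then the equation
`X P X* + X Q + R X* = S` has no solution. -/
theorem quadratic_quaternion_nonreal_no_solution (P Q R S : ℍ[ℝ]) (hP : P.im ≠ 0)
    (St : ℍ[ℝ])
    (hSt : St = S
      + (star Q * P * star R + R * star P * Q) / ((‖P - star P‖ ^ 2 : ℝ) : ℍ[ℝ])
      + R * (star P - P) * Q / ((‖P - star P‖ ^ 2 : ℝ) : ℍ[ℝ])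
      - star Q * star P * Q / ((‖P - star P‖ ^ 2 : ℝ) : ℍ[ℝ])
      - R * star P * star R / ((‖P - star P‖ ^ 2 : ℝ) : ℍ[ℝ]))
    (hreal : St.im = 0) (hne : St ≠ 0) :
    ¬ ∃ X : ℍ[ℝ], X * P * star X + X * Q + R * star X = S := by
  rintro ⟨X, hX⟩
  have hD : P - star P ≠ 0 := by
    intro h
    apply hP
    have h' := congrArg Quaternion.im (sub_eq_zero.mp h)
    rw [Quaternion.im_star] at h'
    have h2 : (2 : ℝ) • P.im = 0 := by rw [two_smul, add_eq_zero_iff_eq_neg, ← h']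
    simpa using h2
  have hn : ‖P - star P‖ ^ 2 ≠ 0 := pow_ne_zero 2 (norm_ne_zero_iff.mpr hD)
  have hDD := sub_star_mul_self P
  generalize ‖P - star P‖ ^ 2 = n at hn hDD hSt
  have hdiv (A : ℍ[ℝ]) : A / (n : ℍ[ℝ]) = n⁻¹ • A := by
    rw [div_eq_mul_inv, ← Quaternion.coe_inv, Quaternion.mul_coe_eq_smul]
  simp only [hdiv] at hSt
  have hcomm : P * (P - star P) = (P - star P) * P := by
    rw [mul_sub, sub_mul, Quaternion.self_mul_star, Quaternion.star_mul_self]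
  obtain ⟨W, hW⟩ : ∃ W, W = n⁻¹ • (P - star P) := ⟨_, rfl⟩
  have hWD : W * (P - star P) = -1 := by
    rw [hW, smul_mul_assoc, hDD, smul_neg, ← Quaternion.coe_smul, smul_eq_mul,
      inv_mul_cancel₀ hn, Quaternion.coe_one]
  have hWPW : W * P * W = -(n⁻¹ • P) := by
    conv_lhs => rw [mul_assoc, hW, mul_smul_comm, hcomm, ← hW, mul_smul_comm, ← mul_assoc, hWD]
    simp
  have hWstar : star W = -W := by
    rw [hW, Quaternion.star_smul, star_sub, star_star, ← smul_neg, neg_sub]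
  have hsq := quadratic_complete_square P Q R X W n⁻¹ hW hWPW
  rw [hX, ← hSt] at hsq
  obtain ⟨Y, hY⟩ : ∃ Y, Y = X + (star Q - R) * W := ⟨_, rfl⟩
  have hYstar : star X - W * (Q - star R) = star Y := by
    rw [hY, star_add, star_mul, hWstar, star_sub, star_star]
    noncomm_ring
  have hAstar : R - (star Q - R) * W * P = star (P * W * (Q - star R) + Q) := by
    have h : W * star P = W * P + 1 := by
      rw [mul_sub] at hWD
      rw [← sub_eq_iff_eq_add', ← neg_sub, hWD, neg_neg]
    simp only [star_add, star_mul, star_sub, star_star, hWstar, neg_mul, mul_neg, h]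
    noncomm_ring
  rw [hYstar, hAstar, ← hY] at hsq
  generalize P * W * (Q - star R) + Q = A at hsq
  have hStar : star St = St := by
    rw [Quaternion.star_eq_self]
    rw [← Quaternion.re_add_im St, hreal]
    simp
  have hYDY : Y * (P - star P) * star Y = 0 := by
    have h : St - star St = Y * (P - star P) * star Y := by
      rw [hsq]
      simp only [star_add, star_mul, star_star]
      noncomm_ring
    rw [← h, hStar, sub_self]
  have hY0 : Y = 0 := by simpa [hD] using hYDY
  exact hne (by rw [hsq, hY0]; simp)
end

section
/- Let P, Q, R, S ∈ ℍ with P ≠ 0, and let L = { X ∈ ℍ : X P X* + X Q + R X* = S } be the solution set of the quadratic quaternion equation X P X* + X Q + R X* = S. Then exactly one of the following holds: (i) L has at most two elements; (ii) L is a 3-sphere, i.e., L = { X ∈ ℍ : |X − c| = r } for some c ∈ ℍ and r > 0; (iii) L is a circle, i.e., L = c + { Y ∈ Π : |Y| = r } for some c ∈ ℍ, some r > 0, and some two-dimensional real linear subspace Π of ℍ. -/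
open Quaternion

/-- `L` has at most two elements. -/
def AtMostTwo (L : Set ℍ[ℝ]) : Prop :=
  ∃ a b : ℍ[ℝ], L ⊆ {a, b}

/-- `L` is a 3-sphere of positive radius in the quaternions. -/
def IsThreeSphere (L : Set ℍ[ℝ]) : Prop :=
  ∃ (c : ℍ[ℝ]) (r : ℝ), 0 < r ∧ L = {X : ℍ[ℝ] | ‖X - c‖ = r}

/-- `L` is a circle of positive radius in the quaternions. -/
def IsCircle (L : Set ℍ[ℝ]) : Prop :=
  ∃ (c : ℍ[ℝ]) (r : ℝ) (W : Submodule ℝ ℍ[ℝ]), 0 < r ∧ Module.finrank ℝ W = 2 ∧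
    L = (fun Y => c + Y) '' {Y : ℍ[ℝ] | Y ∈ W ∧ ‖Y‖ = r}

theorem norm_sq_eq (X : ℍ[ℝ]) : ‖X‖ ^ 2 = X.re ^ 2 + X.imI ^ 2 + X.imJ ^ 2 + X.imK ^ 2 := by
  rw [sq (‖X‖), ← Quaternion.normSq_eq_norm_mul_self, Quaternion.normSq_def']

theorem AtMostTwo.eq_or_eq_or_eq {L : Set ℍ[ℝ]} (h : AtMostTwo L) {x y z : ℍ[ℝ]}
    (hx : x ∈ L) (hy : y ∈ L) (hz : z ∈ L) : x = y ∨ x = z ∨ y = z := by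
  obtain ⟨a, b, hab⟩ := h
  have h1 := hab hx
  have h2 := hab hy
  have h3 := hab hz
  simp only [Set.mem_insert_iff, Set.mem_singleton_iff] at h1 h2 h3
  grind

theorem atMostTwo_of_forall {L : Set ℍ[ℝ]}
    (h : ∀ x ∈ L, ∀ y ∈ L, ∀ z ∈ L, x = y ∨ x = z ∨ y = z) : AtMostTwo L := by
  by_contra hL
  simp only [AtMostTwo, not_exists, Set.not_subset] at hL
  obtain ⟨x, hx, -⟩ := hL 0 0
  obtain ⟨y, hy, hxy⟩ := hL x x
  obtain ⟨z, hz, hxz⟩ := hL x y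
  simp only [Set.mem_insert_iff, Set.mem_singleton_iff] at hxy hxz
  have := h x hx y hy z hz
  grind

theorem IsThreeSphere.not_atMostTwo {L : Set ℍ[ℝ]} (h : IsThreeSphere L) : ¬ AtMostTwo L := by
  obtain ⟨c, r, hr, rfl⟩ := h
  intro h
  have h1 : c + (r : ℍ[ℝ]) ∈ {X : ℍ[ℝ] | ‖X - c‖ = r} := by
    simp [abs_of_pos hr]
  have h2 : c - (r : ℍ[ℝ]) ∈ {X : ℍ[ℝ] | ‖X - c‖ = r} := by
    simp [abs_of_pos hr]
  obtain ⟨i, hi, hi'⟩ : ∃ i : ℍ[ℝ], ‖i‖ = r ∧ i.re = 0 := by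
    refine ⟨⟨0, r, 0, 0⟩, (sq_eq_sq₀ (norm_nonneg _) hr.le).1 ?_, rfl⟩
    exact (norm_sq_eq _).trans (by simp)
  have h3 : c + i ∈ {X : ℍ[ℝ] | ‖X - c‖ = r} := by
    simp [hi]
  rcases h.eq_or_eq_or_eq h1 h2 h3 with h | h | h <;>
  · have h' := congrArg QuaternionAlgebra.re h
    simp [hi'] at h'
    linarith

theorem IsCircle.not_atMostTwo {L : Set ℍ[ℝ]} (h : IsCircle L) : ¬ AtMostTwo L := by
  obtain ⟨c, r, W, hr, hW, rfl⟩ := h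
  intro h
  obtain ⟨v, w, hvw⟩ : ∃ v w : W, LinearIndependent ℝ ![v, w] := by
    have b := Module.finBasisOfFinrankEq ℝ W hW
    refine ⟨b 0, b 1, ?_⟩
    convert b.linearIndependent
    funext i
    fin_cases i <;> rfl
  have hv : (v : ℍ[ℝ]) ≠ 0 := by simpa using hvw.ne_zero 0
  have hw : (w : ℍ[ℝ]) ≠ 0 := by simpa using hvw.ne_zero 1
  have key : ∀ u : W, (u : ℍ[ℝ]) ≠ 0 → ∀ s : ℝ, |s| = 1 →
      c + (s * (r / ‖(u : ℍ[ℝ])‖)) • (u : ℍ[ℝ]) ∈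
        (fun Y => c + Y) '' {Y : ℍ[ℝ] | Y ∈ W ∧ ‖Y‖ = r} := by
    intro u hu s hs
    refine ⟨_, ⟨W.smul_mem _ u.2, ?_⟩, rfl⟩
    have := norm_ne_zero_iff.2 hu
    rw [norm_smul, Real.norm_eq_abs, abs_mul, hs, abs_of_nonneg (by positivity)]
    field_simp
  rw [LinearIndependent.pair_iff] at hvw
  have hrv : r / ‖(v : ℍ[ℝ])‖ ≠ 0 := div_ne_zero hr.ne' (norm_ne_zero_iff.2 hv)
  have hrw : r / ‖(w : ℍ[ℝ])‖ ≠ 0 := div_ne_zero hr.ne' (norm_ne_zero_iff.2 hw)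
  have ne : ∀ s : ℝ, (s * (r / ‖(v : ℍ[ℝ])‖)) • (v : ℍ[ℝ]) ≠
      (1 * (r / ‖(w : ℍ[ℝ])‖)) • (w : ℍ[ℝ]) := by
    intro s h
    have := (hvw (s * (r / ‖(v : ℍ[ℝ])‖)) (-(1 * (r / ‖(w : ℍ[ℝ])‖))) (by
      ext1
      simp only [Submodule.coe_add, Submodule.coe_smul, h, neg_smul, Submodule.coe_zero,
        Submodule.coe_neg, add_neg_cancel])).2
    apply hrw
    linarith
  rcases h.eq_or_eq_or_eq (key v hv 1 (by simp)) (key v hv (-1) (by simp))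
    (key w hw 1 (by simp)) with h | h | h
  · have h' := smul_left_injective ℝ hv (add_left_cancel h)
    apply hrv
    linarith
  · exact ne _ (add_left_cancel h)
  · exact ne _ (add_left_cancel h)

theorem IsThreeSphere.not_isCircle {L : Set ℍ[ℝ]} (h : IsThreeSphere L) : ¬ IsCircle L := by
  obtain ⟨c, r, hr, rfl⟩ := h
  rintro ⟨c', r', W, -, hW, h⟩
  have key : ∀ u : ℍ[ℝ], u ∈ W := by
    intro u
    rcases eq_or_ne u 0 with rfl | hu
    · exact W.zero_mem
    have hu' := norm_ne_zero_iff.2 hu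
    have mem : ∀ s : ℝ, |s| = 1 → c + (s * (r / ‖u‖)) • u ∈ {X : ℍ[ℝ] | ‖X - c‖ = r} := by
      intro s hs
      rw [Set.mem_ofPred_eq, add_sub_cancel_left, norm_smul, Real.norm_eq_abs, abs_mul, hs,
        abs_of_nonneg (by positivity)]
      field_simp
    have h1 := mem 1 (by simp)
    have h2 := mem (-1) (by simp)
    rw [h] at h1 h2
    obtain ⟨y, ⟨hy, -⟩, hy'⟩ := h1
    obtain ⟨z, ⟨hz, -⟩, hz'⟩ := h2
    have hyz : y - z = (2 * (r / ‖u‖)) • u := by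
      have : y - z = (c' + y) - (c' + z) := by abel
      rw [this]
      simp only at hy' hz'
      rw [hy', hz']
      module
    have := W.smul_mem (2 * (r / ‖u‖))⁻¹ (W.sub_mem hy hz)
    rwa [hyz, smul_smul, inv_mul_cancel₀ (by positivity), one_smul] at this
  have : W = ⊤ := by
    ext u
    simp [key u]
  rw [this, finrank_top, Quaternion.finrank_eq_four] at hW
  norm_num at hW

/-- A subset of a line meeting a sphere has at most two elements. -/
theorem atMostTwo_of_line_of_sphere {L : Set ℍ[ℝ]} (p d c : ℍ[ℝ]) (r : ℝ)
    (hline : ∀ x ∈ L, ∃ t : ℝ, x = p + t • d) (hsphere : ∀ x ∈ L, ‖x - c‖ ^ 2 = r) :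
    AtMostTwo L := by
  refine atMostTwo_of_forall fun x hx y hy z hz => ?_
  rcases eq_or_ne d 0 with rfl | hd
  · obtain ⟨_, rfl⟩ := hline x hx
    obtain ⟨_, rfl⟩ := hline y hy
    simp
  have expand : ∀ t : ℝ, ‖p + t • d - c‖ ^ 2 =
      ‖p - c‖ ^ 2 + t * (2 * inner ℝ (p - c) d) + t ^ 2 * ‖d‖ ^ 2 := by
    intro t
    rw [show p + t • d - c = (p - c) + t • d by abel, norm_add_sq_real, inner_smul_right,
      norm_smul, mul_pow, Real.norm_eq_abs, sq_abs]
    ring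
  obtain ⟨s, rfl⟩ := hline x hx
  obtain ⟨t, rfl⟩ := hline y hy
  obtain ⟨u, rfl⟩ := hline z hz
  have h1 := hsphere _ hx
  have h2 := hsphere _ hy
  have h3 := hsphere _ hz
  rw [expand] at h1 h2 h3
  have hD : ‖d‖ ^ 2 ≠ 0 := by positivity
  have prod : (s - t) * ((s - u) * ((t - u) * ‖d‖ ^ 2)) = 0 := by
    linear_combination (t - u) * h1 - (s - u) * h2 + (s - t) * h3
  rcases mul_eq_zero.1 prod with h | h
  · left; rw [sub_eq_zero.1 h]
  rcases mul_eq_zero.1 h with h | h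
  · right; left; rw [sub_eq_zero.1 h]
  rcases mul_eq_zero.1 h with h | h
  · right; right; rw [sub_eq_zero.1 h]
  · exact absurd h hD

theorem norm_smul_add_smul_mul_sq {N : ℍ[ℝ]} (hN : N.re = 0) (A : ℍ[ℝ]) (a b : ℝ) :
    ‖a • A + b • (A * N)‖ ^ 2 = ‖A‖ ^ 2 * (a ^ 2 + b ^ 2 * ‖N‖ ^ 2) := by
  simp only [norm_sq_eq]
  simp [hN]
  ring

/-- A quaternion commuting with a nonzero imaginary quaternion `N` lies in `ℝ + ℝ N`. -/
theorem exists_eq_of_commute_imaginary {N Z : ℍ[ℝ]} (hN : N.re = 0) (hN0 : N ≠ 0)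
    (h : Z * N = N * Z) : ∃ a b : ℝ, Z = a • 1 + b • N := by
  have hn : ‖N‖ ^ 2 ≠ 0 := by positivity
  have hsq := norm_sq_eq N
  rw [hN] at hsq
  refine ⟨Z.re, (Z.imI * N.imI + Z.imJ * N.imJ + Z.imK * N.imK) / ‖N‖ ^ 2, ?_⟩
  have h1 := congrArg QuaternionAlgebra.imI h
  have h2 := congrArg QuaternionAlgebra.imJ h
  have h3 := congrArg QuaternionAlgebra.imK h
  simp [hN] at h1 h2 h3
  ext
  · simp [hN]
  · simp
    field_simp
    rw [hsq]
    linear_combination (-N.imK / 2) * h2 + (N.imJ / 2) * h3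
  · simp
    field_simp
    rw [hsq]
    linear_combination (N.imK / 2) * h1 - (N.imI / 2) * h3
  · simp
    field_simp
    rw [hsq]
    linear_combination (-N.imJ / 2) * h1 + (N.imI / 2) * h2

theorem sandwich_eq_iff {N A Y : ℍ[ℝ]} (hN : N.re = 0) (hN0 : N ≠ 0) (hA : A ≠ 0) :
    Y * N * star Y = A * N * star A ↔
      ∃ a b : ℝ, Y = a • A + b • (A * N) ∧ a ^ 2 + b ^ 2 * ‖N‖ ^ 2 = 1 := by
  have hn : ‖N‖ ≠ 0 := norm_ne_zero_iff.2 hN0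
  have ha : ‖A‖ ≠ 0 := norm_ne_zero_iff.2 hA
  constructor
  · intro h
    have hnorm : ‖Y‖ ^ 2 = ‖A‖ ^ 2 := by
      have := congrArg norm h
      simp only [norm_mul, norm_star] at this
      apply mul_left_cancel₀ hn
      linarith
    have hYY : star Y * Y = ((‖A‖ ^ 2 : ℝ) : ℍ[ℝ]) := by
      rw [Quaternion.star_mul_self, Quaternion.normSq_eq_norm_mul_self, ← sq, hnorm]
    have hAA : star A * A = ((‖A‖ ^ 2 : ℝ) : ℍ[ℝ]) := by
      rw [Quaternion.star_mul_self, Quaternion.normSq_eq_norm_mul_self, ← sq]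
    have hcomm : (star A * Y) * N = N * (star A * Y) := by
      have h' : star A * (Y * N * star Y) * Y = star A * (A * N * star A) * Y := by rw [h]
      have e1 : star A * (Y * N * star Y) * Y = star A * Y * N * (star Y * Y) := by
        simp only [mul_assoc]
      have e2 : star A * (A * N * star A) * Y = (star A * A) * (N * (star A * Y)) := by
        simp only [mul_assoc]
      rw [e1, e2, hYY, hAA, Quaternion.mul_coe_eq_smul, Quaternion.coe_mul_eq_smul] at h'
      exact smul_right_injective _ (pow_ne_zero 2 ha) h'
    obtain ⟨a, b, hab⟩ := exists_eq_of_commute_imaginary hN hN0 hcomm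
    have hY : Y = (a / ‖A‖ ^ 2) • A + (b / ‖A‖ ^ 2) • (A * N) := by
      have h1 : A * (star A * Y) = ‖A‖ ^ 2 • Y := by
        rw [← mul_assoc, Quaternion.self_mul_star, Quaternion.normSq_eq_norm_mul_self, ← sq,
          Quaternion.coe_mul_eq_smul]
      rw [hab, mul_add, mul_smul_comm, mul_smul_comm, mul_one] at h1
      rw [div_eq_inv_mul, div_eq_inv_mul, mul_smul, mul_smul, ← smul_add, h1, smul_smul,
        inv_mul_cancel₀ (pow_ne_zero 2 ha), one_smul]
    refine ⟨_, _, hY, ?_⟩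
    rw [hY, norm_smul_add_smul_mul_sq hN] at hnorm
    apply mul_left_cancel₀ (pow_ne_zero 2 ha)
    rw [hnorm, mul_one]
  · rintro ⟨a, b, rfl, hab⟩
    have hs : star N = -N := by
      ext <;> simp [hN]
    have hNN : N * N = ((-‖N‖ ^ 2 : ℝ) : ℍ[ℝ]) := by
      have := Quaternion.self_mul_star N
      rw [hs, Quaternion.normSq_eq_norm_mul_self, ← sq] at this
      rw [Quaternion.coe_neg, ← this]
      simp
    have hNNN : (a • 1 + b • N) * N * (a • 1 + (-b) • N) = N := by
      have : (a • 1 + b • N) * N * (a • 1 + (-b) • N) =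
          (a ^ 2) • N - b ^ 2 • (N * N * N) := by
        simp only [add_mul, mul_add, smul_mul_assoc, mul_smul_comm, one_mul, mul_one, smul_add,
          smul_smul]
        module
      rw [this, hNN, Quaternion.coe_mul_eq_smul, smul_smul, ← sub_smul]
      rw [show a ^ 2 - b ^ 2 * -‖N‖ ^ 2 = 1 by linarith, one_smul]
    have e1 : a • A + b • (A * N) = A * (a • 1 + b • N) := by
      simp [mul_add]
    have e2 : star (a • A + b • (A * N)) = (a • 1 + (-b) • N) * star A := by
      rw [e1]
      simp [hs]
    rw [e2, e1]
    conv_rhs => rw [← hNNN]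
    simp only [mul_assoc]

theorem finrank_span_pair_mul_imaginary {N A : ℍ[ℝ]} (hN : N.re = 0) (hN0 : N ≠ 0)
    (hA : A ≠ 0) : Module.finrank ℝ (Submodule.span ℝ {A, A * N}) = 2 := by
  have hli : LinearIndependent ℝ ![A, A * N] := by
    rw [LinearIndependent.pair_iff]
    intro s t h
    have h' := norm_smul_add_smul_mul_sq hN A s t
    have hn : 0 < ‖N‖ ^ 2 := by positivity
    have ha : 0 < ‖A‖ ^ 2 := by positivity
    rw [h, norm_zero, zero_pow two_ne_zero, eq_comm, mul_eq_zero, or_iff_right ha.ne'] at h'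
    have ht : t ^ 2 * ‖N‖ ^ 2 = 0 := by nlinarith [sq_nonneg s, mul_nonneg (sq_nonneg t) hn.le]
    have hs : s ^ 2 = 0 := by linarith
    exact ⟨pow_eq_zero_iff two_ne_zero |>.1 hs,
      pow_eq_zero_iff two_ne_zero |>.1 ((mul_eq_zero.1 ht).resolve_right hn.ne')⟩
  rw [← Matrix.range_cons_cons_empty A (A * N) ![], finrank_span_eq_card hli, Fintype.card_fin]

theorem atMostTwo_or_isCircle_of_sandwich {N : ℍ[ℝ]} (hN : N.re = 0) (hN0 : N ≠ 0)
    (T V c : ℍ[ℝ]) (p k : ℝ) :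
    AtMostTwo {X | (X - c) * N * star (X - c) = T ∧ p * ‖X - c‖ ^ 2 + ((X - c) * V).re = k} ∨
    IsCircle {X | (X - c) * N * star (X - c) = T ∧ p * ‖X - c‖ ^ 2 + ((X - c) * V).re = k} := by
  rcases Set.eq_empty_or_nonempty
    {X | (X - c) * N * star (X - c) = T ∧ p * ‖X - c‖ ^ 2 + ((X - c) * V).re = k} with h | h
  · left
    exact ⟨0, 0, h.trans_subset (Set.empty_subset _)⟩
  obtain ⟨X₁, hT, hk⟩ := h
  obtain ⟨A, rfl⟩ : ∃ A, X₁ = c + A := ⟨X₁ - c, by abel⟩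
  rw [add_sub_cancel_left] at hT hk
  rcases eq_or_ne A 0 with rfl | hA
  · left
    refine ⟨c, c, ?_⟩
    rintro X ⟨hX, -⟩
    rw [← hT] at hX
    simpa [hN0, sub_eq_zero] using hX
  have mem_iff : ∀ X, ((X - c) * N * star (X - c) = T ∧
      p * ‖X - c‖ ^ 2 + ((X - c) * V).re = k) ↔
      ∃ a b : ℝ, X - c = a • A + b • (A * N) ∧ a ^ 2 + b ^ 2 * ‖N‖ ^ 2 = 1 ∧
        a * (A * V).re + b * (A * N * V).re = (A * V).re := by
    intro X
    rw [← hT, sandwich_eq_iff hN hN0 hA]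
    have aux : ∀ a b : ℝ, X - c = a • A + b • (A * N) → a ^ 2 + b ^ 2 * ‖N‖ ^ 2 = 1 →
        (p * ‖X - c‖ ^ 2 + ((X - c) * V).re = k ↔
          a * (A * V).re + b * (A * N * V).re = (A * V).re) := by
      intro a b h1 h2
      rw [h1, norm_smul_add_smul_mul_sq hN, h2, ← hk, add_mul, smul_mul_assoc, smul_mul_assoc,
        Quaternion.re_add, Quaternion.re_smul, Quaternion.re_smul]
      simp
    constructor
    · rintro ⟨⟨a, b, h1, h2⟩, h3⟩
      exact ⟨a, b, h1, h2, (aux a b h1 h2).1 h3⟩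
    · rintro ⟨a, b, h1, h2, h3⟩
      exact ⟨⟨a, b, h1, h2⟩, (aux a b h1 h2).2 h3⟩
  simp only [mem_iff]
  generalize (A * V).re = α
  generalize (A * N * V).re = β
  by_cases hαβ : α ^ 2 + β ^ 2 = 0
  · right
    have hα : α = 0 := by nlinarith [sq_nonneg α, sq_nonneg β]
    have hβ : β = 0 := by nlinarith [sq_nonneg α, sq_nonneg β]
    subst hα hβ
    have ha : ‖A‖ ^ 2 ≠ 0 := by positivity
    refine ⟨c, ‖A‖, Submodule.span ℝ {A, A * N}, norm_pos_iff.2 hA,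
      finrank_span_pair_mul_imaginary hN hN0 hA, ?_⟩
    ext X
    constructor
    · rintro ⟨a, b, h1, h2, -⟩
      refine ⟨X - c, ⟨Submodule.mem_span_pair.2 ⟨a, b, h1.symm⟩, ?_⟩, by simp⟩
      rw [← sq_eq_sq₀ (norm_nonneg _) (norm_nonneg _), h1, norm_smul_add_smul_mul_sq hN, h2,
        mul_one]
    · rintro ⟨Y, ⟨hY, hYn⟩, rfl⟩
      obtain ⟨a, b, rfl⟩ := Submodule.mem_span_pair.1 hY
      refine ⟨a, b, by simp, ?_, by simp⟩
      rw [← sq_eq_sq₀ (norm_nonneg _) (norm_nonneg _), norm_smul_add_smul_mul_sq hN] at hYn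
      apply mul_left_cancel₀ ha
      rw [hYn, mul_one]
  · left
    refine atMostTwo_of_line_of_sphere (c + A) ((-β) • A + α • (A * N)) c (‖A‖ ^ 2) ?_ ?_
    · rintro X ⟨a, b, h1, h2, h3⟩
      refine ⟨(α * b - β * (a - 1)) / (α ^ 2 + β ^ 2), ?_⟩
      have ea : a = 1 + (α * b - β * (a - 1)) / (α ^ 2 + β ^ 2) * (-β) := by
        field_simp
        linear_combination α * h3
      have eb : b = (α * b - β * (a - 1)) / (α ^ 2 + β ^ 2) * α := by
        field_simp
        linear_combination β * h3
      generalize (α * b - β * (a - 1)) / (α ^ 2 + β ^ 2) = t at ea eb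
      rw [eq_add_of_sub_eq h1, ea, eb]
      module
    · rintro X ⟨a, b, h1, h2, -⟩
      rw [h1, norm_smul_add_smul_mul_sq hN, h2, mul_one]

theorem norm_sub_sq_eq_iff (V X : ℍ[ℝ]) {p : ℝ} (hp : p ≠ 0) (k : ℝ) :
    p * ‖X‖ ^ 2 + (X * V).re = k ↔
      ‖X - (-(2 * p)⁻¹) • star V‖ ^ 2 = k / p + ‖V‖ ^ 2 / (4 * p ^ 2) := by
  have : ‖X - (-(2 * p)⁻¹) • star V‖ ^ 2 =
      (p * ‖X‖ ^ 2 + (X * V).re) / p + ‖V‖ ^ 2 / (4 * p ^ 2) := by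
    simp only [norm_sq_eq]
    simp
    field_simp
    ring
  rw [this, add_left_inj, div_left_inj' hp]

theorem atMostTwo_or_isThreeSphere_of_norm_sq (V : ℍ[ℝ]) {p : ℝ} (hp : p ≠ 0) (k : ℝ) :
    AtMostTwo {X : ℍ[ℝ] | p * ‖X‖ ^ 2 + (X * V).re = k} ∨
    IsThreeSphere {X : ℍ[ℝ] | p * ‖X‖ ^ 2 + (X * V).re = k} := by
  simp only [norm_sub_sq_eq_iff V _ hp]
  generalize (-(2 * p)⁻¹) • star V = c
  generalize k / p + ‖V‖ ^ 2 / (4 * p ^ 2) = ρ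
  rcases le_or_gt ρ 0 with h | h
  · left
    refine ⟨c, c, fun X (hX : _ = _) => ?_⟩
    have : ‖X - c‖ ^ 2 = 0 := le_antisymm (hX.trans_le h) (sq_nonneg _)
    simpa [sub_eq_zero] using this
  · right
    refine ⟨c, √ρ, Real.sqrt_pos.2 h, ?_⟩
    ext X
    change _ = _ ↔ _ = _
    rw [eq_comm, eq_comm (b := √ρ), Real.sqrt_eq_iff_eq_sq h.le (norm_nonneg _)]

/-- The equation splits into its imaginary and its real part. -/
theorem quadratic_eq_iff (P Q R S X : ℍ[ℝ]) :
    X * P * star X + X * Q + R * star X = S ↔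
      X * P.im * star X + X * ((1 / 2 : ℝ) • (Q - star R)) -
          star ((1 / 2 : ℝ) • (Q - star R)) * star X = S.im ∧
        P.re * ‖X‖ ^ 2 + (X * (Q + star R)).re = S.re := by
  rw [norm_sq_eq]
  simp only [Quaternion.ext_iff]
  simp
  constructor
  · rintro ⟨h1, h2, h3, h4⟩
    refine ⟨⟨?_, ?_, ?_, ?_⟩, ?_⟩ <;> linarith
  · rintro ⟨⟨h1, h2, h3, h4⟩, h5⟩
    refine ⟨?_, ?_, ?_, ?_⟩ <;> linarith

theorem atMostTwo_or_isThreeSphere_or_isCircle {P : ℍ[ℝ]} (Q R S : ℍ[ℝ]) (hP : P ≠ 0) :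
    AtMostTwo {X : ℍ[ℝ] | X * P * star X + X * Q + R * star X = S} ∨
    IsThreeSphere {X : ℍ[ℝ] | X * P * star X + X * Q + R * star X = S} ∨
    IsCircle {X : ℍ[ℝ] | X * P * star X + X * Q + R * star X = S} := by
  simp only [quadratic_eq_iff]
  generalize (1 / 2 : ℝ) • (Q - star R) = U
  generalize Q + star R = V
  have hN : P.im.re = 0 := Quaternion.re_im P
  have hPN : P = (P.re : ℍ[ℝ]) + P.im := (Quaternion.re_add_im P).symm
  generalize P.im = N at *
  generalize P.re = p at *
  generalize S.im = T
  generalize S.re = k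
  rcases eq_or_ne N 0 with rfl | hN0
  · have hp : p ≠ 0 := by
      rintro rfl
      apply hP
      rw [hPN]
      simp
    simp only [mul_zero, zero_mul, zero_add]
    rcases eq_or_ne U 0 with rfl | hU
    · rcases eq_or_ne T 0 with rfl | hT
      · have := atMostTwo_or_isThreeSphere_of_norm_sq V hp k
        simp only [mul_zero, star_zero, zero_mul, sub_zero, true_and]
        tauto
      · left
        refine ⟨0, 0, ?_⟩
        rintro X ⟨hX, -⟩
        exact absurd (by simpa using hX.symm) hT
    · left
      refine atMostTwo_of_line_of_sphere (((1 / 2 : ℝ) • T) * U⁻¹) U⁻¹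
        ((-(2 * p)⁻¹) • star V) _ ?_ fun X hX => (norm_sub_sq_eq_iff V X hp k).1 hX.2
      rintro X ⟨hX, -⟩
      refine ⟨(X * U).re, ?_⟩
      have : X * U = (1 / 2 : ℝ) • T + (((X * U).re : ℝ) : ℍ[ℝ]) := by
        rw [← hX, ← star_mul]
        ext <;> simp <;> ring
      rw [← Quaternion.coe_mul_eq_smul (X * U).re, ← add_mul, ← this, mul_assoc, mul_inv_cancel₀ hU,
        mul_one]
  · have hs : star N = -N := by
      ext <;> simp [hN]
    obtain ⟨c, hc⟩ : ∃ c : ℍ[ℝ], N * star c = -U := by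
      refine ⟨star (-(N⁻¹ * U)), ?_⟩
      rw [star_star, mul_neg, ← mul_assoc, mul_inv_cancel₀ hN0, one_mul]
    have hc' : c * N = star U := by
      have := congrArg star hc
      rwa [star_mul, star_star, hs, mul_neg, star_neg, neg_inj] at this
    have h := atMostTwo_or_isCircle_of_sandwich hN hN0 (T + c * N * star c)
      (V + (2 * p) • star c) c p (k - p * ‖c‖ ^ 2 - (c * V).re)
    have hset : {X | X * N * star X + X * U - star U * star X = T ∧
        p * ‖X‖ ^ 2 + (X * V).re = k} =
        {X | (X - c) * N * star (X - c) = T + c * N * star c ∧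
          p * ‖X - c‖ ^ 2 + ((X - c) * (V + (2 * p) • star c)).re =
            k - p * ‖c‖ ^ 2 - (c * V).re} := by
      ext X
      have e1 : (X - c) * N * star (X - c) =
          X * N * star X + X * U - star U * star X + c * N * star c := by
        have : (X - c) * N * star (X - c) =
            X * N * star X - X * (N * star c) - (c * N) * star X + c * N * star c := by
          rw [star_sub]
          noncomm_ring
        rw [this, hc, hc']
        noncomm_ring
      have e2 : p * ‖X - c‖ ^ 2 + ((X - c) * (V + (2 * p) • star c)).re =
          p * ‖X‖ ^ 2 + (X * V).re - p * ‖c‖ ^ 2 - (c * V).re := by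
        simp only [norm_sq_eq]
        simp
        ring
      change _ ∧ _ ↔ _ ∧ _
      rw [e1, e2, add_left_inj, sub_left_inj, sub_left_inj]
    rw [hset]
    tauto

/-- for any `P ≠ 0`, the solution set `L` of `X P X* + X Q + R X* = S` is
exactly one of: (i) a set with at most two elements; (ii) a 3-sphere; (iii) a circle. -/
theorem quadratic_quaternion_trichotomy (P Q R S : ℍ[ℝ]) (hP : P ≠ 0)
    (L : Set ℍ[ℝ]) (hL : L = {X : ℍ[ℝ] | X * P * star X + X * Q + R * star X = S}) :
    ((∃ a b : ℍ[ℝ], L ⊆ {a, b}) ∧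
      ¬ (∃ (c : ℍ[ℝ]) (r : ℝ), 0 < r ∧ L = {X : ℍ[ℝ] | ‖X - c‖ = r}) ∧
      ¬ (∃ (c : ℍ[ℝ]) (r : ℝ) (W : Submodule ℝ ℍ[ℝ]), 0 < r ∧ Module.finrank ℝ W = 2 ∧
          L = (fun Y => c + Y) '' {Y : ℍ[ℝ] | Y ∈ W ∧ ‖Y‖ = r})) ∨
    (¬ (∃ a b : ℍ[ℝ], L ⊆ {a, b}) ∧
      (∃ (c : ℍ[ℝ]) (r : ℝ), 0 < r ∧ L = {X : ℍ[ℝ] | ‖X - c‖ = r}) ∧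
      ¬ (∃ (c : ℍ[ℝ]) (r : ℝ) (W : Submodule ℝ ℍ[ℝ]), 0 < r ∧ Module.finrank ℝ W = 2 ∧
          L = (fun Y => c + Y) '' {Y : ℍ[ℝ] | Y ∈ W ∧ ‖Y‖ = r})) ∨
    (¬ (∃ a b : ℍ[ℝ], L ⊆ {a, b}) ∧
      ¬ (∃ (c : ℍ[ℝ]) (r : ℝ), 0 < r ∧ L = {X : ℍ[ℝ] | ‖X - c‖ = r}) ∧
      (∃ (c : ℍ[ℝ]) (r : ℝ) (W : Submodule ℝ ℍ[ℝ]), 0 < r ∧ Module.finrank ℝ W = 2 ∧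
        L = (fun Y => c + Y) '' {Y : ℍ[ℝ] | Y ∈ W ∧ ‖Y‖ = r})) := by
  change (AtMostTwo L ∧ ¬ IsThreeSphere L ∧ ¬ IsCircle L) ∨
    (¬ AtMostTwo L ∧ IsThreeSphere L ∧ ¬ IsCircle L) ∨
    (¬ AtMostTwo L ∧ ¬ IsThreeSphere L ∧ IsCircle L)
  have h : AtMostTwo L ∨ IsThreeSphere L ∨ IsCircle L := by
    rw [hL]
    exact atMostTwo_or_isThreeSphere_or_isCircle Q R S hP
  have h1 : IsThreeSphere L → ¬ AtMostTwo L := IsThreeSphere.not_atMostTwo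
  have h2 : IsCircle L → ¬ AtMostTwo L := IsCircle.not_atMostTwo
  have h3 : IsThreeSphere L → ¬ IsCircle L := IsThreeSphere.not_isCircle
  tauto
end
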